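/- Let 3 = p_1 < p_2 < p_3 < … be the increasing sequence of all odd prime numbers. There exists an absolute constant c_1 > 0 such that for every sequence (ε_i)_{i ≥ 1} taking values in {0, 1} and every sufficiently large real number x, there exists a positive integer n < x such that e_{p_i}(n) ≡ ε_i (mod 2) holds for all i = 1, …, k(x), where k(x) := ⌊c_1 (log x / (log log x)^6)^{1/9}⌋. -/

import Mathlib

/-- For a prime `p`, `e_p(n)` is the exponent of `p` in the factorization of `n!`. -/
def factorialExp (p n : ℕ) : ℕ := (Nat.factorial n).factorization p

/-- `oddPrime i` is the `(i+1)`-st odd prime, so `oddPrime 0 = 3`, `oddPrime 1 = 5`, …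
(i.e. `p_{i+1}` in the enumeration `3 = p₁ < p₂ < …` of all odd primes). -/
noncomputable def oddPrime (i : ℕ) : ℕ := Nat.nth (fun q => q.Prime ∧ Odd q) i

theorem fe_rec (p n : ℕ) (hp : p.Prime) :
    factorialExp p n = n / p + factorialExp p (n / p) := by
  have := Fact.mk hp
  unfold factorialExp
  rw [Nat.factorization_def _ hp, Nat.factorization_def _ hp]
  conv_lhs => rw [← Nat.div_add_mod n p]
  rw [padicValNat_factorial_mul_add _ (Nat.mod_lt _ hp.pos), padicValNat_factorial_mul]
  ring

theorem fe_add (p : ℕ) (hp : p.Prime) (m : ℕ) : ∀ a b, a < p ^ m →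
    factorialExp p (a + p ^ m * b) = factorialExp p a + factorialExp p (p ^ m * b) := by
  induction m with
  | zero =>
    intro a b h
    have : a = 0 := by simpa using h
    subst this
    simp [factorialExp]
  | succ m ih =>
    intro a b h
    have h1 : (a + p ^ (m + 1) * b) / p = a / p + p ^ m * b := by
      rw [show a + p ^ (m + 1) * b = a + p * (p ^ m * b) by ring, Nat.add_mul_div_left _ _ hp.pos]
    have h2 : (p ^ (m + 1) * b) / p = p ^ m * b := by
      rw [show p ^ (m + 1) * b = p * (p ^ m * b) by ring, Nat.mul_div_cancel_left _ hp.pos]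
    rw [fe_rec p _ hp, h1, ih, fe_rec p a hp, fe_rec p (p ^ (m + 1) * b) hp, h2]
    · ring
    · rw [Nat.div_lt_iff_lt_mul hp.pos, ← pow_succ]; exact h

/-- sign -/
def chi (p n : ℕ) : ℤ := (-1) ^ factorialExp p n

/-- block sign -/
def sg (p s : ℕ) : ℤ := (-1) ^ (s / p + s / (p * p))

theorem chi_block (p : ℕ) (hp : p.Prime) (ho : Odd p) (r s : ℕ) :
    chi p (p * p * r + s) = sg p s * chi p (r + s / (p * p)) := by
  have h1 : (p * p * r + s) / p = p * r + s / p := by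
    rw [show p * p * r + s = s + p * (p * r) by ring, Nat.add_mul_div_left _ _ hp.pos]; ring
  have h2 : (p * r + s / p) / p = r + s / (p * p) := by
    rw [show p * r + s / p = s / p + p * r by ring, Nat.add_mul_div_left _ _ hp.pos,
      Nat.div_div_eq_div_mul]; ring
  unfold chi sg
  rw [fe_rec p _ hp, h1, fe_rec p (p * r + s / p) hp, h2, ← pow_add]
  rw [show p * r + s / p + (r + s / (p * p) + factorialExp p (r + s / (p * p)))
    = (p + 1) * r + (s / p + s / (p * p) + factorialExp p (r + s / (p * p))) by ring, pow_add]
  have : Even ((p + 1) * r) := (ho.add_one).mul_right r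
  rw [this.neg_one_pow, one_mul]

/-- the structured shifts -/
def RR (q y : ℕ) : ℕ → ℕ → ℕ
  | 0, _ => 0
  | L + 1, i => q * RR q y L (i / 2) + (i % 2) * y

theorem sum_range_two_mul (f : ℕ → ℤ) (N : ℕ) :
    ∑ i ∈ Finset.range (2 * N), f i = ∑ i ∈ Finset.range N, (f (2 * i) + f (2 * i + 1)) := by
  induction N with
  | zero => simp
  | succ N ih =>
    rw [show 2 * (N + 1) = 2 * N + 1 + 1 by ring, Finset.sum_range_succ, Finset.sum_range_succ,
      Finset.sum_range_succ, ih]; ring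

theorem sum_range_block (f : ℕ → ℤ) (q W : ℕ) :
    ∑ i ∈ Finset.range (q * W), f i =
      ∑ b ∈ Finset.range q, ∑ j ∈ Finset.range W, f (b + q * j) := by
  rw [Finset.sum_comm]
  induction W with
  | zero => simp
  | succ W ih =>
    rw [Finset.sum_range_succ, ← ih, mul_add, mul_one, Finset.sum_range_add]
    congr 1
    exact Finset.sum_congr rfl fun x _ => by rw [add_comm]

theorem RR_lt (q y : ℕ) (hy : y < q) (L : ℕ) : ∀ i, RR q y L i < q ^ L := by
  induction L with
  | zero => intro i; simp [RR]
  | succ L ih =>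
    intro i
    have h := ih (i / 2)
    have h2 : (i % 2) * y ≤ y := by
      have := Nat.mod_lt i (show 2 > 0 by norm_num)
      nlinarith
    rw [RR, pow_succ]
    nlinarith

/-- correlation -/
def Phi (p y L s t : ℕ) : ℤ :=
  ∑ i ∈ Finset.range (2 ^ L), chi p (RR (p * p) y L i + s) * chi p (RR (p * p) y L i + t)

theorem Phi_succ (p y : ℕ) (hp : p.Prime) (ho : Odd p) (L s t : ℕ) :
    Phi p y (L + 1) s t = sg p s * sg p t * Phi p y L (s / (p * p)) (t / (p * p)) +
      sg p (s + y) * sg p (t + y) * Phi p y L ((s + y) / (p * p)) ((t + y) / (p * p)) := by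
  unfold Phi
  rw [pow_succ, mul_comm (2 ^ L) 2, sum_range_two_mul, Finset.sum_add_distrib, Finset.mul_sum,
    Finset.mul_sum]
  congr 1
  · refine Finset.sum_congr rfl fun i _ => ?_
    have : RR (p * p) y (L + 1) (2 * i) = p * p * RR (p * p) y L i := by
      simp [RR]
    rw [this, chi_block p hp ho, chi_block p hp ho]; ring
  · refine Finset.sum_congr rfl fun i _ => ?_
    have : RR (p * p) y (L + 1) (2 * i + 1) = p * p * RR (p * p) y L i + y := by
      have h1 : (2 * i + 1) / 2 = i := by omega
      have h2 : (2 * i + 1) % 2 = 1 := by omega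
      simp [RR, h1, h2]
    rw [this, add_assoc, add_assoc, add_comm y s, add_comm y t, chi_block p hp ho,
      chi_block p hp ho]; ring

/-- indicator of high residues without carry -/
def hiI (y s : ℕ) : ℤ :=
  if s % ((2 * y + 1) * (2 * y + 1)) < (2 * y + 1) * (2 * y) ∧ y + 1 ≤ s % (2 * y + 1) then 1 else 0

/-- indicator of low residues without carry -/
def loI (y s : ℕ) : ℤ :=
  if s % ((2 * y + 1) * (2 * y + 1)) < (2 * y + 1) * (2 * y) ∧ s % (2 * y + 1) < y + 1 then 1 else 0

theorem sum_periodic (f : ℕ → ℤ) (q : ℕ) (hf : ∀ s, f (s + q) = f s) (n : ℕ) :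
    ∑ b ∈ Finset.range q, f (n + b) = ∑ b ∈ Finset.range q, f b := by
  induction n with
  | zero => simp
  | succ n ih =>
    rw [← ih]
    have h1 := Finset.sum_range_succ (fun b => f (n + b)) q
    have h2 := Finset.sum_range_succ' (fun b => f (n + b)) q
    rw [h1] at h2
    rw [hf n] at h2
    simp only [add_zero] at h2
    rw [add_left_inj] at h2
    rw [h2]
    exact Finset.sum_congr rfl fun b _ => by congr 1; ring

theorem sum_ind (y : ℕ) (P : ℕ → Prop) [DecidablePred P] (n : ℕ) :
    ∑ b ∈ Finset.range ((2 * y + 1) * (2 * y + 1)),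
      (if (n + b) % ((2 * y + 1) * (2 * y + 1)) < (2 * y + 1) * (2 * y) ∧
        P ((n + b) % (2 * y + 1)) then (1 : ℤ) else 0)
      = 2 * y * ∑ b ∈ Finset.range (2 * y + 1), if P b then (1 : ℤ) else 0 := by
  rw [sum_periodic (fun s => (if s % ((2 * y + 1) * (2 * y + 1)) < (2 * y + 1) * (2 * y) ∧
        P (s % (2 * y + 1)) then (1 : ℤ) else 0))]
  · rw [sum_range_block, Finset.mul_sum]
    refine Finset.sum_congr rfl fun b hb => ?_
    rw [Finset.mem_range] at hb
    rw [Finset.sum_range_succ]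
    have h1 : ∀ j, (b + (2 * y + 1) * j) % (2 * y + 1) = b := by
      intro j
      rw [Nat.add_mul_mod_self_left, Nat.mod_eq_of_lt hb]
    have h2 : ∀ j, j < 2 * y + 1 → (b + (2 * y + 1) * j) % ((2 * y + 1) * (2 * y + 1)) =
        b + (2 * y + 1) * j := by
      intro j hj
      apply Nat.mod_eq_of_lt
      nlinarith
    rw [h2 _ (by omega), if_neg (by intro h; omega), add_zero]
    rw [Finset.sum_congr rfl (g := fun _ => if P b then (1 : ℤ) else 0)]
    · simp
    · intro j hj
      rw [Finset.mem_range] at hj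
      have h3 : b + (2 * y + 1) * j < (2 * y + 1) * (2 * y) := by nlinarith
      rw [h1, h2 _ (by omega)]
      simp [h3]
  · intro s
    have : (s + (2 * y + 1) * (2 * y + 1)) % (2 * y + 1) = s % (2 * y + 1) := by
      rw [Nat.add_mul_mod_self_left]
    rw [this, Nat.add_mod_right]

theorem sum_hi (y n : ℕ) : ∑ b ∈ Finset.range ((2 * y + 1) * (2 * y + 1)), hiI y (n + b)
    = 2 * y * y := by
  unfold hiI
  rw [sum_ind y (fun x => y + 1 ≤ x) n, show 2 * y + 1 = (y + 1) + y by ring,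
    Finset.sum_range_add, Finset.sum_eq_zero]
  · simp
  · intro x hx
    rw [Finset.mem_range] at hx
    rw [if_neg (by omega)]

theorem sum_lo (y n : ℕ) : ∑ b ∈ Finset.range ((2 * y + 1) * (2 * y + 1)), loI y (n + b)
    = 2 * y * (y + 1) := by
  unfold loI
  rw [sum_ind y (fun x => x < y + 1) n, show 2 * y + 1 = (y + 1) + y by ring,
    Finset.sum_range_add, Finset.sum_congr rfl (g := fun _ => (1 : ℤ))]
  · simp
    left
    intro x _
    omega
  · intro x hx
    rw [Finset.mem_range] at hx
    rw [if_pos hx]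

theorem sg_lo (y s : ℕ) (hs : s % ((2 * y + 1) * (2 * y + 1)) < (2 * y + 1) * (2 * y))
    (h : s % (2 * y + 1) < y + 1) :
    (s + y) / ((2 * y + 1) * (2 * y + 1)) = s / ((2 * y + 1) * (2 * y + 1)) ∧
    sg (2 * y + 1) (s + y) = sg (2 * y + 1) s := by
  have h0 : (s + y) / ((2 * y + 1) * (2 * y + 1)) = s / ((2 * y + 1) * (2 * y + 1)) := by
    have := Nat.div_add_mod s ((2 * y + 1) * (2 * y + 1))
    apply Nat.div_eq_of_lt_le
    · rw [mul_comm]; omega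
    · nlinarith
  have h1 : (s + y) / (2 * y + 1) = s / (2 * y + 1) := by
    have := Nat.div_add_mod s (2 * y + 1)
    apply Nat.div_eq_of_lt_le
    · rw [mul_comm]; omega
    · nlinarith
  refine ⟨h0, ?_⟩
  unfold sg
  rw [h0, h1]

theorem sg_hi (y s : ℕ) (hs : s % ((2 * y + 1) * (2 * y + 1)) < (2 * y + 1) * (2 * y))
    (h : y + 1 ≤ s % (2 * y + 1)) :
    (s + y) / ((2 * y + 1) * (2 * y + 1)) = s / ((2 * y + 1) * (2 * y + 1)) ∧
    sg (2 * y + 1) (s + y) = - sg (2 * y + 1) s := by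
  have h0 : (s + y) / ((2 * y + 1) * (2 * y + 1)) = s / ((2 * y + 1) * (2 * y + 1)) := by
    have := Nat.div_add_mod s ((2 * y + 1) * (2 * y + 1))
    apply Nat.div_eq_of_lt_le
    · rw [mul_comm]; omega
    · nlinarith
  have h1 : (s + y) / (2 * y + 1) = s / (2 * y + 1) + 1 := by
    have := Nat.div_add_mod s (2 * y + 1)
    have := Nat.mod_lt s (show 2 * y + 1 > 0 by omega)
    apply Nat.div_eq_of_lt_le
    · nlinarith
    · nlinarith
  refine ⟨h0, ?_⟩
  unfold sg
  rw [h0, h1]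
  ring

theorem sg_abs (p s : ℕ) : |sg p s| = 1 := by
  unfold sg; rw [abs_pow]; simp

theorem Phi_abs (p y : ℕ) (hp : p.Prime) (ho : Odd p) (L s t : ℕ) :
    |Phi p y (L + 1) s t| ≤ |Phi p y L (s / (p * p)) (t / (p * p))| +
      |Phi p y L ((s + y) / (p * p)) ((t + y) / (p * p))| := by
  rw [Phi_succ p y hp ho]
  refine (abs_add_le _ _).trans (le_of_eq ?_)
  simp [abs_mul, sg_abs]

theorem Phi_zero1 (y : ℕ) (hp : (2 * y + 1).Prime) (L s t : ℕ) (h1 : hiI y s = 1)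
    (h2 : loI y t = 1) : Phi (2 * y + 1) y (L + 1) s t = 0 := by
  unfold hiI at h1
  unfold loI at h2
  rw [ite_eq_left_iff] at h1 h2
  have h1 : s % ((2 * y + 1) * (2 * y + 1)) < (2 * y + 1) * (2 * y) ∧
    y + 1 ≤ s % (2 * y + 1) := by
    by_contra h; simpa using h1 h
  have h2 : t % ((2 * y + 1) * (2 * y + 1)) < (2 * y + 1) * (2 * y) ∧
    t % (2 * y + 1) < y + 1 := by
    by_contra h; simpa using h2 h
  obtain ⟨a, b⟩ := sg_hi y s h1.1 h1.2
  obtain ⟨c, d⟩ := sg_lo y t h2.1 h2.2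
  rw [Phi_succ _ _ hp ⟨y, rfl⟩, a, b, c, d]
  ring

theorem Phi_comm (p y L s t : ℕ) : Phi p y L s t = Phi p y L t s := by
  unfold Phi
  exact Finset.sum_congr rfl fun _ _ => mul_comm _ _

theorem ind_cases (y s : ℕ) : (hiI y s = 0 ∧ loI y s = 0) ∨ (hiI y s = 1 ∧ loI y s = 0) ∨
    (hiI y s = 0 ∧ loI y s = 1) := by
  unfold hiI loI
  split_ifs with h1 h2 h2
  · omega
  · simp
  · simp
  · simp

theorem hiI_add (y s j : ℕ) : hiI y (s + (2 * y + 1) * (2 * y + 1) * j) = hiI y s := by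
  unfold hiI
  rw [Nat.add_mul_mod_self_left, mul_assoc (2 * y + 1), Nat.add_mul_mod_self_left]

theorem loI_add (y s j : ℕ) : loI y (s + (2 * y + 1) * (2 * y + 1) * j) = loI y s := by
  unfold loI
  rw [Nat.add_mul_mod_self_left, mul_assoc (2 * y + 1), Nat.add_mul_mod_self_left]

theorem D_bound (y M : ℕ) (hp : (2 * y + 1).Prime) (L : ℕ) : ∀ n m : ℕ,
    ∑ j ∈ Finset.range (((2 * y + 1) * (2 * y + 1)) ^ L * M),
      ∑ i ∈ Finset.range (((2 * y + 1) * (2 * y + 1)) ^ L * M),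
        |Phi (2 * y + 1) y L (n + j) (m + i)| ≤
      2 ^ L * (M : ℤ) ^ 2 * ((2 * y + 1) ^ 4 - 8 * y ^ 3 * (y + 1)) ^ L := by
  induction L with
  | zero =>
    intro n m
    have : ∀ a b, |Phi (2 * y + 1) y 0 a b| = 1 := by
      intro a b
      simp [Phi, chi, abs_mul, abs_pow]
    simp [this]
    nlinarith
  | succ L ih =>
    intro n m
    set q := (2 * y + 1) * (2 * y + 1) with hq
    have hq0 : 0 < q := by positivity
    set W := q ^ L * M with hW
    set B : ℤ := 2 ^ L * (M : ℤ) ^ 2 * ((2 * y + 1) ^ 4 - 8 * y ^ 3 * (y + 1)) ^ L with hB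
    have hWq : q ^ (L + 1) * M = q * W := by rw [hW]; ring
    have key : ∀ b c : ℕ, ∑ j ∈ Finset.range W, ∑ i ∈ Finset.range W,
        |Phi (2 * y + 1) y (L + 1) (n + (b + q * j)) (m + (c + q * i))| ≤
        2 * B * (1 - hiI y (n + b) * loI y (m + c) - loI y (n + b) * hiI y (m + c)) := by
      intro b c
      have gen : ∑ j ∈ Finset.range W, ∑ i ∈ Finset.range W,
          |Phi (2 * y + 1) y (L + 1) (n + (b + q * j)) (m + (c + q * i))| ≤ 2 * B := by
        have e1 : ∀ u v j, (u + (v + q * j)) / q = (u + v) / q + j := by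
          intro u v j
          rw [← add_assoc, Nat.add_mul_div_left _ _ hq0]
        have e2 : ∀ u v j, (u + (v + q * j) + y) / q = (u + v + y) / q + j := by
          intro u v j
          rw [show u + (v + q * j) + y = u + v + y + q * j by ring, Nat.add_mul_div_left _ _ hq0]
        calc _ ≤ ∑ j ∈ Finset.range W, ∑ i ∈ Finset.range W,
              (|Phi (2 * y + 1) y L ((n + b) / q + j) ((m + c) / q + i)| +
              |Phi (2 * y + 1) y L ((n + b + y) / q + j) ((m + c + y) / q + i)|) := by
              refine Finset.sum_le_sum fun j _ => Finset.sum_le_sum fun i _ => ?_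
              refine (Phi_abs _ _ hp ⟨y, rfl⟩ _ _ _).trans (le_of_eq ?_)
              rw [← hq, e1, e1, e2, e2]
          _ ≤ 2 * B := by
              simp only [Finset.sum_add_distrib]
              linarith [ih ((n + b) / q) ((m + c) / q), ih ((n + b + y) / q) ((m + c + y) / q)]
      have z1 : hiI y (n + b) = 1 → loI y (m + c) = 1 → ∑ j ∈ Finset.range W,
          ∑ i ∈ Finset.range W,
          |Phi (2 * y + 1) y (L + 1) (n + (b + q * j)) (m + (c + q * i))| = 0 := by
        intro h1 h2
        refine Finset.sum_eq_zero fun j _ => Finset.sum_eq_zero fun i _ => ?_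
        rw [Phi_zero1 y hp, abs_zero]
        · rw [← add_assoc, hiI_add, h1]
        · rw [← add_assoc, loI_add, h2]
      have z2 : loI y (n + b) = 1 → hiI y (m + c) = 1 → ∑ j ∈ Finset.range W,
          ∑ i ∈ Finset.range W,
          |Phi (2 * y + 1) y (L + 1) (n + (b + q * j)) (m + (c + q * i))| = 0 := by
        intro h1 h2
        refine Finset.sum_eq_zero fun j _ => Finset.sum_eq_zero fun i _ => ?_
        rw [Phi_comm, Phi_zero1 y hp, abs_zero]
        · rw [← add_assoc, hiI_add, h2]
        · rw [← add_assoc, loI_add, h1]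
      rcases ind_cases y (n + b) with h | h | h <;> rcases ind_cases y (m + c) with h' | h' | h'
      case inr.inl.inr.inr => rw [z1 h.1 h'.2, h.1, h.2, h'.1, h'.2]; simp
      case inr.inr.inr.inl => rw [z2 h.2 h'.1, h.1, h.2, h'.1, h'.2]; simp
      all_goals
        rw [h.1, h.2, h'.1, h'.2]; simpa using gen
    rw [hWq, sum_range_block]
    have step : ∀ b j, ∑ i ∈ Finset.range (q * W),
        |Phi (2 * y + 1) y (L + 1) (n + (b + q * j)) (m + i)| =
        ∑ c ∈ Finset.range q, ∑ i ∈ Finset.range W,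
        |Phi (2 * y + 1) y (L + 1) (n + (b + q * j)) (m + (c + q * i))| := by
      intro b j
      rw [sum_range_block (fun i => |Phi (2 * y + 1) y (L + 1) (n + (b + q * j)) (m + i)|)]
    simp only [step]
    have step2 : ∀ b, ∑ j ∈ Finset.range W, ∑ c ∈ Finset.range q, ∑ i ∈ Finset.range W,
        |Phi (2 * y + 1) y (L + 1) (n + (b + q * j)) (m + (c + q * i))| =
        ∑ c ∈ Finset.range q, ∑ j ∈ Finset.range W, ∑ i ∈ Finset.range W,
        |Phi (2 * y + 1) y (L + 1) (n + (b + q * j)) (m + (c + q * i))| :=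
      fun b => Finset.sum_comm
    simp only [step2]
    calc _ ≤ ∑ b ∈ Finset.range q, ∑ c ∈ Finset.range q, 2 * B *
        (1 - hiI y (n + b) * loI y (m + c) - loI y (n + b) * hiI y (m + c)) :=
          Finset.sum_le_sum fun b _ => Finset.sum_le_sum fun c _ => key b c
      _ = 2 * B * (q * q - (∑ b ∈ Finset.range q, hiI y (n + b)) *
            (∑ c ∈ Finset.range q, loI y (m + c)) - (∑ b ∈ Finset.range q, loI y (n + b)) *
            (∑ c ∈ Finset.range q, hiI y (m + c))) := by
          rw [Finset.sum_mul_sum, Finset.sum_mul_sum]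
          simp only [← Finset.mul_sum, Finset.sum_sub_distrib]
          simp
      _ = _ := by
          rw [sum_hi, sum_lo, sum_hi, sum_lo, hB, hq]
          push_cast
          ring

theorem step_lemma (y M L : ℕ) (hp : (2 * y + 1).Prime) (T : ℕ)
    (hT : T = ((2 * y + 1) * (2 * y + 1)) ^ L * M) {C : Type} [DecidableEq C] (c : ℕ → C) :
    ∃ r < ((2 * y + 1) * (2 * y + 1)) ^ L, ∀ w : C,
      81 ^ L * (∑ t ∈ (Finset.range T).filter (fun t => c t = w), chi (2 * y + 1) (r + t)) ^ 2
        ≤ 65 ^ L * (T : ℤ) ^ 2 := by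
  have hy : 1 ≤ y := by
    rcases Nat.eq_zero_or_pos y with h | h
    · subst h; exact absurd hp (by norm_num)
    · exact h
  set p := 2 * y + 1 with hpdef
  set R := RR (p * p) y L with hR
  set K : ℤ := (2 * y + 1) ^ 4 - 8 * y ^ 3 * (y + 1) with hK
  have hD := D_bound y M hp L 0 0
  rw [← hpdef, ← hT, ← hK] at hD
  simp only [zero_add] at hD
  set B : C → Finset ℕ := fun w => (Finset.range T).filter (fun t => c t = w) with hB
  have hsum : ∑ i ∈ Finset.range (2 ^ L), ∑ w ∈ (Finset.range T).image c,
      (∑ t ∈ B w, chi p (R i + t)) ^ 2 ≤ ∑ i ∈ Finset.range (2 ^ L), (M : ℤ) ^ 2 * K ^ L := by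
    calc _ = ∑ w ∈ (Finset.range T).image c, ∑ t ∈ B w, ∑ u ∈ B w, Phi p y L t u := by
          rw [Finset.sum_comm]
          refine Finset.sum_congr rfl fun w _ => ?_
          simp only [sq, Finset.sum_mul_sum]
          rw [Finset.sum_comm]
          refine Finset.sum_congr rfl fun t _ => ?_
          rw [Finset.sum_comm]
          rfl
      _ ≤ ∑ w ∈ (Finset.range T).image c, ∑ t ∈ B w, ∑ u ∈ Finset.range T, |Phi p y L t u| := by
          refine Finset.sum_le_sum fun w _ => Finset.sum_le_sum fun t _ => ?_
          refine (Finset.sum_le_sum fun u _ => le_abs_self _).trans ?_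
          exact Finset.sum_le_sum_of_subset_of_nonneg (Finset.filter_subset _ _)
            fun _ _ _ => abs_nonneg _
      _ = ∑ t ∈ Finset.range T, ∑ u ∈ Finset.range T, |Phi p y L t u| :=
          Finset.sum_fiberwise_of_maps_to (fun t ht => Finset.mem_image_of_mem _ ht) _
      _ ≤ _ := by
          refine hD.trans (le_of_eq ?_)
          simp
          ring
  obtain ⟨i, _, hi⟩ := Finset.exists_le_of_sum_le (by simp) hsum
  refine ⟨R i, RR_lt _ _ (by nlinarith) _ _, fun w => ?_⟩
  have hK0 : 81 * K ≤ 65 * ((p * p) ^ 2 : ℕ) := by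
    obtain ⟨z, rfl⟩ := Nat.exists_eq_add_of_le hy
    rw [hK, hpdef]
    push_cast
    have : (0 : ℤ) ≤ z := by positivity
    ring_nf
    nlinarith [pow_nonneg this 2, pow_nonneg this 3, pow_nonneg this 4]
  have hKn : 0 ≤ K := by
    rw [hK]
    have : (0 : ℤ) ≤ y := by positivity
    ring_nf
    nlinarith [pow_nonneg this 2, pow_nonneg this 3, pow_nonneg this 4]
  have hle : (∑ t ∈ B w, chi p (R i + t)) ^ 2 ≤ (M : ℤ) ^ 2 * K ^ L := by
    by_cases hw : w ∈ (Finset.range T).image c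
    · refine le_trans ?_ hi
      exact Finset.single_le_sum (f := fun w => (∑ t ∈ B w, chi p (R i + t)) ^ 2)
        (fun _ _ => sq_nonneg _) hw
    · have : B w = ∅ := by
        rw [hB, Finset.filter_eq_empty_iff]
        intro t ht h
        exact hw (Finset.mem_image.2 ⟨t, ht, h⟩)
      rw [this]
      simp
      positivity
  calc _ ≤ 81 ^ L * ((M : ℤ) ^ 2 * K ^ L) := by gcongr
    _ = (81 * K) ^ L * (M : ℤ) ^ 2 := by rw [mul_pow]; ring
    _ ≤ (65 * ((p * p) ^ 2 : ℕ)) ^ L * (M : ℤ) ^ 2 := by gcongr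
    _ = _ := by rw [hT]; push_cast; ring

theorem chi_cases (p n : ℕ) : chi p n = 1 ∨ chi p n = -1 := by
  unfold chi; exact neg_one_pow_eq_or ℤ _

/-- splitting a finite set by a sign -/
theorem split_sign (S : Finset ℕ) (f : ℕ → ℤ) (hf : ∀ t, f t = 1 ∨ f t = -1) (v : ℤ)
    (hv : v = 1 ∨ v = -1) :
    2 * ((S.filter (fun t => f t = v)).card : ℤ) = S.card + v * ∑ t ∈ S, f t := by
  rw [Finset.card_filter, Finset.card_eq_sum_ones]
  push_cast
  rw [Finset.mul_sum, Finset.mul_sum, ← Finset.sum_add_distrib]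
  refine Finset.sum_congr rfl fun t _ => ?_
  rcases hf t with h | h <;> rcases hv with h' | h' <;> rw [h, h'] <;> norm_num

open Classical in
theorem all_patterns (k : ℕ) (p : ℕ → ℕ) (hp : ∀ i, (p i).Prime) (ho : ∀ i, Odd (p i))
    (T L : ℕ) (hL : L = 11 * k) (hT0 : 0 < T) (hT : ∀ i < k, (p i * p i) ^ L ∣ T) :
    ∀ i ≤ k, ∃ r : ℕ → ℕ, (∀ j < i, r j < (p j * p j) ^ L) ∧
      ∀ v : ℕ → ℤ, (∀ j, v j = 1 ∨ v j = -1) →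
        T ≤ 3 ^ i * ((Finset.range T).filter
          (fun t => ∀ j < i, chi (p j) (r j + t) = v j)).card := by
  intro i
  induction i with
  | zero => intro _; exact ⟨fun _ => 0, by simp, by simp⟩
  | succ i ih =>
    intro hi
    obtain ⟨r, hr, hrv⟩ := ih (by omega)
    obtain ⟨y, hy⟩ := ho i
    obtain ⟨M, hM⟩ := hT i (by omega)
    have hpi := hp i
    rw [hy] at hpi hM
    obtain ⟨s, hs, hsw⟩ := step_lemma y M L hpi T hM
      (fun t => fun j : ℕ => if j < i then chi (p j) (r j + t) else 0)
    refine ⟨Function.update r i s, ?_, ?_⟩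
    · intro j hj
      rcases Nat.lt_succ_iff_lt_or_eq.1 hj with h | h
      · rw [Function.update_of_ne (by omega)]; exact hr j h
      · subst h; rw [Function.update_self, hy]; exact hs
    · intro v hv
      have h1 := hrv v hv
      have h2 := hsw (fun j => if j < i then v j else 0)
      have e1 : (Finset.range T).filter (fun t => (fun j : ℕ => if j < i then chi (p j) (r j + t)
          else 0) = (fun j => if j < i then v j else 0)) =
          (Finset.range T).filter (fun t => ∀ j < i, chi (p j) (r j + t) = v j) := by
        refine Finset.filter_congr fun t _ => ?_
        constructor
        · intro h j hj
          have := congrFun h j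
          simpa [hj] using this
        · intro h
          funext j
          split_ifs with hj
          · exact h j hj
          · rfl
      rw [e1, ← hy] at h2
      set S := (Finset.range T).filter (fun t => ∀ j < i, chi (p j) (r j + t) = v j) with hS
      have e2 : (Finset.range T).filter (fun t => ∀ j < i + 1,
          chi (p j) (Function.update r i s j + t) = v j) =
          S.filter (fun t => chi (p i) (s + t) = v i) := by
        rw [hS, Finset.filter_filter]
        refine Finset.filter_congr fun t _ => ?_
        constructor
        · intro h
          refine ⟨fun j hj => ?_, ?_⟩
          · have := h j (by omega)
            rwa [Function.update_of_ne (by omega)] at this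
          · have := h i (by omega)
            rwa [Function.update_self] at this
        · rintro ⟨h, h'⟩ j hj
          rcases Nat.lt_succ_iff_lt_or_eq.1 hj with h3 | h3
          · rw [Function.update_of_ne (by omega)]; exact h j h3
          · subst h3; rw [Function.update_self]; exact h'
      rw [e2]
      have h3 := split_sign S (fun t => chi (p i) (s + t)) (fun t => chi_cases _ _) (v i) (hv i)
      set A := ∑ t ∈ S, chi (p i) (s + t) with hA
      -- bound on A
      have h4 : (3 : ℤ) ^ (i + 1) * |A| ≤ T := by
        apply abs_le_of_sq_le_sq' _ (by positivity) |>.2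
        have hpos : (0 : ℤ) < 81 ^ L := by positivity
        refine le_of_mul_le_mul_left ?_ hpos
        have hnum : (65 : ℤ) ^ L * 9 ^ (i + 1) ≤ 81 ^ L := by
          calc (65 : ℤ) ^ L * 9 ^ (i + 1) ≤ 65 ^ L * 9 ^ k := by
                gcongr; norm_num
            _ = (65 ^ 11 * 9) ^ k := by rw [hL, pow_mul, mul_pow]
            _ ≤ (81 ^ 11) ^ k := by gcongr; norm_num
            _ = 81 ^ L := by rw [hL, pow_mul]
        calc (81 : ℤ) ^ L * (3 ^ (i + 1) * |A|) ^ 2 = 9 ^ (i + 1) * (81 ^ L * A ^ 2) := by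
              rw [mul_pow, sq_abs, ← pow_mul, mul_comm (i + 1) 2, pow_mul]; norm_num; ring
          _ ≤ 9 ^ (i + 1) * (65 ^ L * (T : ℤ) ^ 2) := by gcongr
          _ = (65 ^ L * 9 ^ (i + 1)) * (T : ℤ) ^ 2 := by ring
          _ ≤ 81 ^ L * (T : ℤ) ^ 2 := by gcongr
      have h5 : -|A| ≤ v i * A := by
        rcases hv i with h | h <;> rw [h]
        · linarith [neg_abs_le A]
        · linarith [le_abs_self A]
      have h1' : (T : ℤ) ≤ 3 ^ i * (S.card : ℤ) := by exact_mod_cast h1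
      zify
      have hpow : (0 : ℤ) < 3 ^ i := by positivity
      rw [pow_succ] at h4 ⊢
      nlinarith [mul_le_mul_of_nonneg_left h5 hpow.le]

theorem oddPrime_inf : (setOf (fun q : ℕ => q.Prime ∧ Odd q)).Infinite := by
  have h := Nat.infinite_setOf_prime.diff (Set.finite_singleton 2)
  refine h.mono ?_
  rintro q ⟨hq, h2⟩
  exact ⟨hq, hq.odd_of_ne_two h2⟩

theorem oddPrime_spec (i : ℕ) : (oddPrime i).Prime ∧ Odd (oddPrime i) :=
  Nat.nth_mem_of_infinite oddPrime_inf i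

theorem oddPrime_le_of_lt (i q : ℕ) (hq : q.Prime ∧ Odd q) (h : ∀ j < i, oddPrime j < q) :
    oddPrime i ≤ q := by
  have h1 : Nat.nth (fun q : ℕ => q.Prime ∧ Odd q) (Nat.count (fun q : ℕ => q.Prime ∧ Odd q) q) = q :=
    Nat.nth_count hq
  have h2 : i ≤ Nat.count (fun q : ℕ => q.Prime ∧ Odd q) q := by
    by_contra hlt
    have := h _ (not_le.1 hlt)
    unfold oddPrime at this
    omega
  calc oddPrime i ≤ _ := (Nat.nth_strictMono oddPrime_inf).monotone h2
    _ = q := h1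

theorem oddPrime_le (i : ℕ) : oddPrime i ≤ 2 ^ (i + 2) := by
  induction i with
  | zero =>
    have := oddPrime_le_of_lt 0 3 ⟨by norm_num, by decide⟩ (by simp)
    omega
  | succ i ih =>
    obtain ⟨q, hq, h1, h2⟩ := Nat.exists_prime_lt_and_le_two_mul (oddPrime i)
      (oddPrime_spec i).1.ne_zero
    have := oddPrime_le_of_lt (i + 1) q ⟨hq, hq.odd_of_ne_two (by
      have := (oddPrime_spec i).1.two_le; omega)⟩ (by
        intro j hj
        refine lt_of_le_of_lt ?_ h1
        exact (Nat.nth_strictMono oddPrime_inf).monotone (by omega))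
    rw [show i + 1 + 2 = (i + 2) + 1 by ring, pow_succ]
    omega

theorem main_nat (k : ℕ) (hk : 1 ≤ k) (ε : ℕ → ℕ) :
    ∃ n : ℕ, 0 < n ∧ n < 2 ^ (92 * k ^ 5) ∧
      ∀ i < k, factorialExp (oddPrime i) n ≡ ε i [MOD 2] := by
  classical
  set p := oddPrime with hpdef
  have hp : ∀ i, (p i).Prime := fun i => (oddPrime_spec i).1
  have ho : ∀ i, Odd (p i) := fun i => (oddPrime_spec i).2
  have hple : ∀ i ∈ Finset.range k, p i ≤ 2 ^ (k + 1) := by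
    intro i hi
    rw [Finset.mem_range] at hi
    exact (oddPrime_le i).trans (Nat.pow_le_pow_right (by norm_num) (by omega))
  set L := 11 * k with hL
  set T := ∏ j ∈ Finset.range k, (p j * p j) ^ L with hT
  have hT0 : 0 < T := Finset.prod_pos fun j _ => by have := (hp j).pos; positivity
  have hTd : ∀ i < k, (p i * p i) ^ L ∣ T := fun i hi =>
    Finset.dvd_prod_of_mem (fun j => (p j * p j) ^ L) (Finset.mem_range.2 hi)
  obtain ⟨r, hr, hrv⟩ := all_patterns k p hp ho T L hL hT0 hTd k le_rfl
  set m := 22 * k ^ 2 * (k + 1) + 1 with hm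
  have hTle : T ≤ 2 ^ (22 * k ^ 2 * (k + 1)) := by
    calc T ≤ ∏ j ∈ Finset.range k, (2 ^ (k + 1) * 2 ^ (k + 1)) ^ L := by
          refine Finset.prod_le_prod' fun j hj => ?_
          have := hple j hj
          gcongr
      _ = 2 ^ (22 * k ^ 2 * (k + 1)) := by
          rw [Finset.prod_const, Finset.card_range, ← pow_add, ← pow_mul, ← pow_mul, hL]
          congr 1; ring
  have hpm : ∀ i, 2 * T ≤ p i ^ m := by
    intro i
    calc 2 * T ≤ 2 * 2 ^ (22 * k ^ 2 * (k + 1)) := by gcongr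
      _ = 2 ^ m := by rw [hm, pow_succ]; ring
      _ ≤ p i ^ m := Nat.pow_le_pow_left (hp i).two_le _
  have hinj : Function.Injective p := (Nat.nth_strictMono oddPrime_inf).injective
  have hs0 : ∀ i ∈ Finset.range k, p i ^ m ≠ 0 := fun i _ => pow_ne_zero _ (hp i).ne_zero
  have hcop : Set.Pairwise (↑(Finset.range k)) (Function.onFun Nat.Coprime (fun i => p i ^ m)) := by
    intro i _ j _ hij
    exact Nat.Coprime.pow _ _ ((Nat.coprime_primes (hp i) (hp j)).2 fun h => hij (hinj h))
  set N := (Nat.chineseRemainderOfFinset r (fun i => p i ^ m) (Finset.range k) hs0 hcop : ℕ) with hN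
  have hNlt : N < ∏ i ∈ Finset.range k, p i ^ m :=
    Nat.chineseRemainderOfFinset_lt_prod r (fun i => p i ^ m) hs0 hcop
  have hNmod : ∀ i < k, N ≡ r i [MOD p i ^ m] := fun i hi =>
    (Nat.chineseRemainderOfFinset r (fun i => p i ^ m) (Finset.range k) hs0 hcop).2 i
      (Finset.mem_range.2 hi)
  set Q := ∏ i ∈ Finset.range k, p i ^ m with hQ
  have hQ0 : 0 < Q := by omega
  have hQle : Q ≤ 2 ^ ((k + 1) * m * k) := by
    calc Q ≤ ∏ j ∈ Finset.range k, (2 ^ (k + 1)) ^ m := by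
          refine Finset.prod_le_prod' fun j hj => ?_
          have := hple j hj
          gcongr
      _ = _ := by rw [Finset.prod_const, Finset.card_range, ← pow_mul, ← pow_mul, mul_assoc]
  have hrT : ∀ i < k, r i < T := fun i hi =>
    lt_of_lt_of_le (hr i hi) (Nat.le_of_dvd hT0 (hTd i hi))
  have hrep : ∀ i, ∃ b, i < k → N + Q = r i + p i ^ m * b := by
    intro i
    by_cases hi : i < k
    · have h1 : N + Q ≡ r i [MOD p i ^ m] := by
        have h2 : Q ≡ 0 [MOD p i ^ m] := (Nat.modEq_zero_iff_dvd).2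
          (Finset.dvd_prod_of_mem (fun j => p j ^ m) (Finset.mem_range.2 hi))
        simpa using (hNmod i hi).add h2
      have h3 : r i % p i ^ m = r i := Nat.mod_eq_of_lt (by
        have := hrT i hi; have := hpm i; omega)
      refine ⟨(N + Q) / p i ^ m, fun _ => ?_⟩
      have h4 := Nat.mod_add_div (N + Q) (p i ^ m)
      rw [h1, h3] at h4
      exact h4.symm
    · exact ⟨0, fun h => absurd h hi⟩
  choose b hb using hrep
  have hcard := hrv (fun i => (-1) ^ (ε i + factorialExp (p i) (p i ^ m * b i)))
    (fun i => neg_one_pow_eq_or ℤ _)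
  have hne : ((Finset.range T).filter (fun t => ∀ j < k, chi (p j) (r j + t) =
      (-1) ^ (ε j + factorialExp (p j) (p j ^ m * b j)))).Nonempty := by
    rw [← Finset.card_pos]
    by_contra h
    have h0 := Nat.eq_zero_of_not_pos h
    rw [h0] at hcard
    omega
  obtain ⟨t, ht⟩ := hne
  rw [Finset.mem_filter, Finset.mem_range] at ht
  obtain ⟨htT, ht⟩ := ht
  refine ⟨N + Q + t, by omega, ?_, ?_⟩
  · have hTQ : T ≤ 2 ^ ((k + 1) * m * k) := by
      refine hTle.trans (Nat.pow_le_pow_right (by norm_num) ?_)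
      rw [hm]
      nlinarith [Nat.zero_le (22 * k ^ 2 * (k + 1)), Nat.mul_le_mul_left (22 * k ^ 2 * (k + 1)) hk]
    have hexp : (k + 1) * m * k + 2 ≤ 92 * k ^ 5 := by
      have h1 : m ≤ 45 * k ^ 3 := by
        rw [hm]
        have := Nat.one_le_pow 3 k hk
        have h2 : k ^ 2 ≤ k ^ 3 := Nat.pow_le_pow_right hk (by norm_num)
        nlinarith
      have h5 := Nat.one_le_pow 5 k hk
      calc (k + 1) * m * k + 2 ≤ (2 * k) * (45 * k ^ 3) * k + 2 * k ^ 5 := by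
            gcongr <;> omega
        _ = 92 * k ^ 5 := by ring
    calc N + Q + t < 2 ^ ((k + 1) * m * k + 2) := by rw [pow_add]; omega
      _ ≤ _ := Nat.pow_le_pow_right (by norm_num) hexp
  · intro i hi
    have h1 : N + Q + t = (r i + t) + p i ^ m * b i := by rw [hb i hi]; ring
    rw [h1, fe_add (p i) (hp i) m _ _ (by
      have := hrT i hi; have := hpm i; omega)]
    have h2 := ht i hi
    unfold chi at h2
    have h3 : (-1 : ℤ) ^ (factorialExp (p i) (r i + t) + (ε i + factorialExp (p i) (p i ^ m * b i)))
        = 1 := by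
      rw [pow_add, h2, ← pow_add, ← two_mul]
      exact (even_two_mul _).neg_one_pow
    rw [neg_one_pow_eq_one_iff_even (by norm_num), Nat.even_iff] at h3
    unfold Nat.ModEq
    omega

/-- There is an absolute constant `c₁ > 0` such that for every
`{0,1}`-valued sequence `(εᵢ)_{i ≥ 1}` and all sufficiently large `x`, some
positive integer `n < x` satisfies `e_{pᵢ}(n) ≡ εᵢ (mod 2)` for all
`1 ≤ i ≤ k(x) = ⌊c₁ (log x/(log log x)^6)^{1/9}⌋`. -/
theorem stmt_3 :
    ∃ c₁ : ℝ, 0 < c₁ ∧ ∀ ε : ℕ → ℕ, (∀ i, ε i ≤ 1) →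
      ∃ x₀ : ℝ, ∀ x : ℝ, x₀ ≤ x →
        ∃ n : ℕ, 0 < n ∧ (n : ℝ) < x ∧
          ∀ i : ℕ, 1 ≤ i →
            i ≤ ⌊c₁ * (Real.log x / (Real.log (Real.log x)) ^ 6) ^ ((1 : ℝ) / 9)⌋₊ →
            factorialExp (oddPrime (i - 1)) n ≡ ε i [MOD 2] := by
  refine ⟨1, one_pos, fun ε _ => ⟨Real.exp (4 ^ 9), fun x hx => ?_⟩⟩
  have hx0 : 0 < x := lt_of_lt_of_le (Real.exp_pos _) hx
  have hlog : (4 : ℝ) ^ 9 ≤ Real.log x := (Real.le_log_iff_exp_le hx0).2 hx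
  have hlog0 : 0 < Real.log x := lt_of_lt_of_le (by positivity) hlog
  have hll : 1 ≤ Real.log (Real.log x) := by
    rw [Real.le_log_iff_exp_le hlog0]
    have := Real.exp_one_lt_d9
    norm_num at hlog
    linarith
  set k := ⌊1 * (Real.log x / (Real.log (Real.log x)) ^ 6) ^ ((1 : ℝ) / 9)⌋₊ with hk
  set z := (Real.log x) ^ ((1 : ℝ) / 9) with hz
  have hz9 : z ^ 9 = Real.log x := by
    rw [hz, ← Real.rpow_natCast, ← Real.rpow_mul hlog0.le]; norm_num
  have hz0 : 0 ≤ z := by positivity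
  have hz4 : 4 ≤ z := by
    apply le_of_pow_le_pow_left₀ (n := 9) (by norm_num) hz0
    rw [hz9]; exact hlog
  have hkz : (k : ℝ) ≤ z := by
    refine (Nat.floor_le (by positivity)).trans ?_
    rw [one_mul]
    apply Real.rpow_le_rpow (by positivity) _ (by norm_num)
    exact div_le_self hlog0.le (one_le_pow₀ hll)
  rcases Nat.eq_zero_or_pos k with h0 | h0
  · refine ⟨1, one_pos, ?_, fun i h1 h2 => by omega⟩
    have := Real.add_one_le_exp ((4 : ℝ) ^ 9)
    norm_num at this hx ⊢
    linarith
  · obtain ⟨n, hn0, hn, hmod⟩ := main_nat k h0 (fun i => ε (i + 1))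
    refine ⟨n, hn0, ?_, fun i h1 h2 => ?_⟩
    · have e1 : (n : ℝ) < 2 ^ (92 * k ^ 5) := by exact_mod_cast hn
      refine lt_of_lt_of_le e1 ?_
      have e2 : (2 : ℝ) ≤ Real.exp 1 := by
        have := Real.add_one_le_exp (1 : ℝ); linarith
      calc (2 : ℝ) ^ (92 * k ^ 5) ≤ (Real.exp 1) ^ (92 * k ^ 5) := by gcongr
        _ = Real.exp (92 * (k : ℝ) ^ 5) := by rw [← Real.exp_nat_mul]; push_cast; rw [mul_one]
        _ ≤ Real.exp (Real.log x) := by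
            apply Real.exp_le_exp.2
            calc 92 * (k : ℝ) ^ 5 ≤ z ^ 4 * z ^ 5 := by
                  gcongr
                  calc (92 : ℝ) ≤ 4 ^ 4 := by norm_num
                    _ ≤ z ^ 4 := by gcongr
              _ = z ^ 9 := by ring
              _ = Real.log x := hz9
        _ = x := Real.exp_log hx0
    · have := hmod (i - 1) (by omega)
      rwa [show i - 1 + 1 = i by omega] at this
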